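/- Let μ ∈ ℤⁿ, let y₁ = τ_α(y(p,e,b,g)) ∈ Gr⁰_{−α}, and let y₂ ∈ Gr_{μ+α}. Then Φ_{α,k}(m(y₁,y₂)) = e ≠ 0, so ξ_α(m(y₁,y₂)) is defined, and ξ_α(m(y₁,y₂)) = y₁. -/

import Mathlib

open Matrix

noncomputable section

/-- `K = ℂ((t⁻¹))`, the field of formal Laurent series in `t⁻¹`.  We realize it as
`LaurentSeries ℂ`, where the Laurent-series variable `X` plays the role of `t⁻¹`;
thus for `f : K`, `f.coeff j` is the coefficient of `t^{-j}`. -/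
abbrev K : Type := LaurentSeries ℂ

/-- The element `t` (the inverse of the Laurent series variable). -/
def tK : K := (HahnSeries.single (-1 : ℤ) (1 : ℂ))

/-- The constant embedding `ℂ → K`. -/
def Cc (z : ℂ) : K := HahnSeries.C z

/-- `f ∈ 𝒪 = ℂ[[t⁻¹]]` : no positive powers of `t`. -/
def memO (f : K) : Prop := ∀ j : ℤ, j < 0 → f.coeff j = 0

/-- `f ∈ 𝒪₁ = t⁻¹ℂ[[t⁻¹]]`. -/
def memO1 (f : K) : Prop := ∀ j : ℤ, j ≤ 0 → f.coeff j = 0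

/-- `f ∈ ℂ[t]`. -/
def memPoly (f : K) : Prop := ∀ j : ℤ, 0 < j → f.coeff j = 0

/-- Upper unitriangular matrix. -/
def IsUpperUni {R : Type*} [Zero R] [One R] {m : ℕ} (M : Matrix (Fin m) (Fin m) R) : Prop :=
  (∀ i, M i i = 1) ∧ ∀ i j : Fin m, j < i → M i j = 0

/-- Lower unitriangular matrix. -/
def IsLowerUni {R : Type*} [Zero R] [One R] {m : ℕ} (M : Matrix (Fin m) (Fin m) R) : Prop :=
  (∀ i, M i i = 1) ∧ ∀ i j : Fin m, i < j → M i j = 0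

/-- `M ∈ N₁[[t⁻¹]]` : upper unitriangular with off-diagonal entries in `𝒪₁`. -/
def MemN1 {m : ℕ} (M : Matrix (Fin m) (Fin m) K) : Prop :=
  IsUpperUni M ∧ ∀ i j : Fin m, i ≠ j → memO1 (M i j)

/-- `M ∈ N₋,₁[[t⁻¹]]`. -/
def MemN1neg {m : ℕ} (M : Matrix (Fin m) (Fin m) K) : Prop :=
  IsLowerUni M ∧ ∀ i j : Fin m, i ≠ j → memO1 (M i j)

/-- `M ∈ T₁[[t⁻¹]]` : diagonal with entries in `1 + 𝒪₁`. -/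
def MemT1 {m : ℕ} (M : Matrix (Fin m) (Fin m) K) : Prop :=
  (∀ i j : Fin m, i ≠ j → M i j = 0) ∧ ∀ i, memO1 (M i i - 1)

/-- `M ∈ N[t]` : upper unitriangular with entries in `ℂ[t]`. -/
def MemNpoly {m : ℕ} (M : Matrix (Fin m) (Fin m) K) : Prop :=
  IsUpperUni M ∧ ∀ i j : Fin m, memPoly (M i j)

/-- `M ∈ N₋[t]` : lower unitriangular with entries in `ℂ[t]`. -/
def MemNnegPoly {m : ℕ} (M : Matrix (Fin m) (Fin m) K) : Prop :=
  IsLowerUni M ∧ ∀ i j : Fin m, memPoly (M i j)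

/-- `t^ν = diag(t^{ν₁},…,t^{ν_m})`. -/
def tPow {m : ℕ} (ν : Fin m → ℤ) : Matrix (Fin m) (Fin m) K :=
  Matrix.diagonal fun i => tK ^ ν i

/-- `y = u · h · t^ν · l` is a Gauss factorization exhibiting membership in `Gr_ν`. -/
def IsGauss {m : ℕ} (ν : Fin m → ℤ) (y u h l : Matrix (Fin m) (Fin m) K) : Prop :=
  MemN1 u ∧ MemT1 h ∧ MemN1neg l ∧ y = u * h * tPow ν * l

/-- The matrix slice `Gr_ν = N₁[[t⁻¹]]·T₁[[t⁻¹]]·t^ν·N₋,₁[[t⁻¹]]`. -/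
def GrSlice {m : ℕ} (ν : Fin m → ℤ) : Set (Matrix (Fin m) (Fin m) K) :=
  { y | ∃ u h l, IsGauss ν y u h l }

/-- Block embedding `τ_α : Mat_{k+1} → Mat_n` into (1-indexed) rows and columns `r₁,…,r₁+k`,
identity outside this block. -/
def blockEmbed {R : Type*} [Zero R] [One R] (n r₁ k : ℕ)
    (g : Matrix (Fin (k+1)) (Fin (k+1)) R) : Matrix (Fin n) (Fin n) R :=
  fun i j =>
    if h : r₁ - 1 ≤ (i : ℕ) ∧ (i : ℕ) ≤ r₁ - 1 + k ∧ r₁ - 1 ≤ (j : ℕ) ∧ (j : ℕ) ≤ r₁ - 1 + k then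
      g ⟨(i : ℕ) - (r₁ - 1), by omega⟩ ⟨(j : ℕ) - (r₁ - 1), by omega⟩
    else if i = j then 1 else 0

/-- The coweight `α` of `PGL_n` : `α_{r₁} = 1`, `α_{r₂+1} = -1` (1-indexed), all other
entries `0`. -/
def alphaCo (n r₁ r₂ : ℕ) : Fin n → ℤ :=
  fun i => if (i : ℕ) = r₁ - 1 then 1 else if (i : ℕ) = r₂ then -1 else 0

/-- The matrix `y(p,e,b,g)` (matrix representative of a point of the open Zastava
`Gr⁰_{-α}`), a `(k+1)×(k+1)` matrix over `ℂ[t] ⊆ K`. -/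
def ymat (k : ℕ) (p e : ℂ) (b g : Fin (k-1) → ℂ) :
    Matrix (Fin (k+1)) (Fin (k+1)) K :=
  fun i j =>
    if _hi0 : (i : ℕ) = 0 then
      (if _hjk : (j : ℕ) = k then Cc e else 0)
    else if _hik : (i : ℕ) = k then
      (if _hj0 : (j : ℕ) = 0 then Cc (-e⁻¹)
       else if _hjk : (j : ℕ) = k then tK - Cc (p + ∑ l : Fin (k-1), b l * g l)
       else Cc (-(g ⟨k - (j : ℕ) - 1, by have := j.isLt; omega⟩)))
    else
      (if _hji : (j : ℕ) = (i : ℕ) then 1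
       else if _hjk : (j : ℕ) = k then Cc (b ⟨k - (i : ℕ) - 1, by have := i.isLt; omega⟩)
       else 0)

/-- The matrix `x₋(v)` over `K` : identity except for the bottom row `(v_k,…,v₁,1)`. -/
def xminusK (k : ℕ) (v : Fin k → ℂ) : Matrix (Fin (k+1)) (Fin (k+1)) K :=
  fun i j =>
    if _hik : (i : ℕ) = k then
      (if _hjk : (j : ℕ) = k then 1 else Cc (v ⟨k - (j : ℕ) - 1, by have := j.isLt; omega⟩))
    else if i = j then 1 else 0

/-- `Φ_α(y)` read off from the `N₁[[t⁻¹]]`-factor `u` of a Gauss factorization of `y`. -/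
def PhiOf (n r₂ k : ℕ) (hrn : r₂ < n) (u : Matrix (Fin n) (Fin n) K) : Fin k → ℂ :=
  fun a => (u ⟨r₂ - 1 - (a : ℕ), by omega⟩ ⟨r₂, hrn⟩).coeff 1

/-- `ζ_α(y)` read off from the `N₁[[t⁻¹]]`-factor `u` of a Gauss factorization of `y`. -/
def ZetaOf (n r₁ r₂ k : ℕ) (hr1 : 1 ≤ r₁) (hrr : r₁ ≤ r₂) (hrn : r₂ < n)
    (hk : k = r₂ - r₁ + 1) (u : Matrix (Fin n) (Fin n) K) : Fin k → ℂ :=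
  fun a =>
    if _ha : (a : ℕ) = k - 1 then (u ⟨r₁ - 1, by omega⟩ ⟨r₂, hrn⟩).coeff 2
    else (u ⟨r₁ - 1, by omega⟩ ⟨r₁ + (a : ℕ), by have := a.isLt; omega⟩).coeff 1

/-- `ξ_α(y)`, computed from the `N₁[[t⁻¹]]`-factor `u` of a Gauss factorization of `y`. -/
def xiOf (n r₁ r₂ k : ℕ) (hr1 : 1 ≤ r₁) (hrr : r₁ ≤ r₂) (hrn : r₂ < n)
    (hk : k = r₂ - r₁ + 1) (u : Matrix (Fin n) (Fin n) K) : Matrix (Fin n) (Fin n) K :=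
  let c := PhiOf n r₂ k hrn u
  let z := ZetaOf n r₁ r₂ k hr1 hrr hrn hk u
  let e : ℂ := c ⟨k - 1, by omega⟩
  let b : Fin (k-1) → ℂ := fun i => c ⟨(i : ℕ), by have := i.isLt; omega⟩
  let g : Fin (k-1) → ℂ := fun i => z ⟨k - (i : ℕ) - 2, by omega⟩ / e
  let p : ℂ := z ⟨k - 1, by omega⟩ / e - ∑ i : Fin (k-1), b i * g i
  blockEmbed n r₁ k (ymat k p e b g)

/-- `M` has identity submatrix in (1-indexed) rows and columns `r₁,…,r₁+k`. -/
def HasIdBlock {R : Type*} [Zero R] [One R] {n : ℕ} (r₁ k : ℕ)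
    (M : Matrix (Fin n) (Fin n) R) : Prop :=
  ∀ i j : Fin n, r₁ - 1 ≤ (i : ℕ) → (i : ℕ) ≤ r₁ - 1 + k →
    r₁ - 1 ≤ (j : ℕ) → (j : ℕ) ≤ r₁ - 1 + k →
    M i j = if i = j then 1 else 0

/-- `M ∈ N^α(K)` : upper unitriangular over `K` with identity `(k+1)×(k+1)`-block. -/
def MemNalphaK (n r₁ k : ℕ) (M : Matrix (Fin n) (Fin n) K) : Prop :=
  IsUpperUni M ∧ HasIdBlock r₁ k M

/-- `M ∈ N^α[t]`. -/
def MemNalphaPoly (n r₁ k : ℕ) (M : Matrix (Fin n) (Fin n) K) : Prop :=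
  MemNalphaK n r₁ k M ∧ ∀ i j : Fin n, memPoly (M i j)

/-- `M ∈ N(K)^α₁ = x_α(N_{1,k+1}[[t⁻¹]])·N^α(K)`. -/
def MemNKalpha1 (n r₁ k : ℕ) (M : Matrix (Fin n) (Fin n) K) : Prop :=
  ∃ (a : Matrix (Fin (k+1)) (Fin (k+1)) K) (u : Matrix (Fin n) (Fin n) K),
    MemN1 a ∧ MemNalphaK n r₁ k u ∧ M = blockEmbed n r₁ k a * u

/-- `z = π(x)` for the slice `Gr_ν` : `z ∈ Gr_ν` and `z = a·x·b` with `a ∈ N[t]`,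
`b ∈ N₋[t]`. -/
def IsPiOf {n : ℕ} (ν : Fin n → ℤ) (x z : Matrix (Fin n) (Fin n) K) : Prop :=
  z ∈ GrSlice ν ∧ ∃ a b, MemNpoly a ∧ MemNnegPoly b ∧ z = a * x * b

/-- The open Zastava slice `Gr⁰_{-α} ⊆ GL_n(K)` : matrices `τ_α(y(p,e,b,g))`. -/
def GrZeroNegAlpha (n r₁ k : ℕ) : Set (Matrix (Fin n) (Fin n) K) :=
  { M | ∃ (p e : ℂ) (b g : Fin (k-1) → ℂ), e ≠ 0 ∧ M = blockEmbed n r₁ k (ymat k p e b g) }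

/-- `μ + α`. -/
def addAlpha (n r₁ r₂ : ℕ) (μ : Fin n → ℤ) : Fin n → ℤ :=
  fun i => μ i + alphaCo n r₁ r₂ i


/-! ### Coefficients of Laurent series -/

/-- `f` has no terms `t^{-j}` with `j < d`. -/
def VanishBelow (d : ℤ) (f : K) : Prop := ∀ j : ℤ, j < d → f.coeff j = 0

/-- `f` has leading term `t^{-d}`. -/
def LeadOne (d : ℤ) (f : K) : Prop := VanishBelow d f ∧ f.coeff d = 1

theorem memO1_iff (f : K) : memO1 f ↔ VanishBelow 1 f :=
  ⟨fun h j hj => h j (by omega), fun h j hj => h j (by omega)⟩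

theorem VanishBelow.mono {a b : ℤ} {f : K} (h : VanishBelow b f) (hab : a ≤ b) :
    VanishBelow a f := fun j hj => h j (by omega)

theorem VanishBelow.zero (d : ℤ) : VanishBelow d 0 := fun _ _ => rfl

theorem VanishBelow.add {d : ℤ} {f g : K} (hf : VanishBelow d f) (hg : VanishBelow d g) :
    VanishBelow d (f + g) := fun j hj => by simp [hf j hj, hg j hj]

theorem VanishBelow.neg {d : ℤ} {f : K} (hf : VanishBelow d f) :
    VanishBelow d (-f) := fun j hj => by simp [hf j hj]

theorem VanishBelow.sub {d : ℤ} {f g : K} (hf : VanishBelow d f) (hg : VanishBelow d g) :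
    VanishBelow d (f - g) := fun j hj => by simp [hf j hj, hg j hj]

theorem coeff_sum {ι : Type*} (s : Finset ι) (f : ι → K) (j : ℤ) :
    (∑ i ∈ s, f i).coeff j = ∑ i ∈ s, (f i).coeff j := by
  simp

theorem VanishBelow.sum {ι : Type*} {s : Finset ι} {f : ι → K} {d : ℤ}
    (hf : ∀ i ∈ s, VanishBelow d (f i)) : VanishBelow d (∑ i ∈ s, f i) := fun j hj => by
  rw [coeff_sum]
  exact Finset.sum_eq_zero fun i hi => hf i hi j hj

theorem VanishBelow.mul {a b : ℤ} {f g : K} (hf : VanishBelow a f) (hg : VanishBelow b g) :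
    VanishBelow (a + b) (f * g) := fun j hj => by
  rw [HahnSeries.coeff_mul]
  refine Finset.sum_eq_zero fun x hx => ?_
  rw [Finset.mem_antidiagonal] at hx
  by_cases h : x.1 < a
  · rw [hf _ h, zero_mul]
  · rw [hg _ (by omega), mul_zero]

theorem VanishBelow.coeff_mul {a b : ℤ} {f g : K} (hf : VanishBelow a f)
    (hg : VanishBelow b g) : (f * g).coeff (a + b) = f.coeff a * g.coeff b := by
  rw [HahnSeries.coeff_mul, Finset.sum_eq_single (a, b)]
  · intro x hx hne
    rw [Finset.mem_antidiagonal] at hx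
    by_cases h : x.1 < a
    · rw [hf _ h, zero_mul]
    · by_cases h' : x.2 < b
      · rw [hg _ h', mul_zero]
      · exact absurd (Prod.ext (by omega) (by omega)) hne
  · intro h
    by_contra h0
    refine h (Finset.mem_antidiagonal.2 ⟨?_, ?_, rfl⟩)
    · exact fun h1 => h0 (by simp [h1])
    · exact fun h1 => h0 (by simp [h1])

theorem VanishBelow.Cc (z : ℂ) : VanishBelow 0 (Cc z) := fun j hj => by
  simp [_root_.Cc, HahnSeries.coeff_single_of_ne hj.ne, HahnSeries.C_apply]

@[simp] theorem coeff_Cc_zero (z : ℂ) : (Cc z).coeff 0 = z := by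
  simp [Cc]

theorem LeadOne.one : LeadOne 0 (1 : K) :=
  ⟨fun j hj => by simp [HahnSeries.coeff_one, hj.ne], by simp⟩

theorem LeadOne.mul {a b : ℤ} {f g : K} (hf : LeadOne a f) (hg : LeadOne b g) :
    LeadOne (a + b) (f * g) :=
  ⟨hf.1.mul hg.1, by rw [hf.1.coeff_mul hg.1, hf.2, hg.2, one_mul]⟩

theorem LeadOne.ne_zero {a : ℤ} {f : K} (hf : LeadOne a f) : f ≠ 0 := by
  rintro rfl
  simpa using hf.2

theorem LeadOne.inv {a : ℤ} {f : K} (hf : LeadOne a f) : LeadOne (-a) f⁻¹ := by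
  have h0 := hf.ne_zero
  have ho : f.order = a := by
    refine le_antisymm (HahnSeries.order_le_of_coeff_ne_zero (by rw [hf.2]; exact one_ne_zero)) ?_
    exact (HahnSeries.le_order_iff_forall h0).2 hf.1
  have hi : (f⁻¹).order = -a := by
    have h := HahnSeries.order_mul h0 (inv_ne_zero h0)
    rw [mul_inv_cancel₀ h0, HahnSeries.order_one, ho] at h
    omega
  have hv : VanishBelow (-a) f⁻¹ := fun j hj =>
    HahnSeries.coeff_eq_zero_of_lt_order (by omega)
  refine ⟨hv, ?_⟩
  have h := hf.1.coeff_mul hv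
  rw [mul_inv_cancel₀ h0, hf.2, one_mul, add_neg_cancel] at h
  rw [← h]
  simp

theorem LeadOne.add {a : ℤ} {f g : K} (hf : LeadOne a f) (hg : VanishBelow (a + 1) g) :
    LeadOne a (f + g) :=
  ⟨hf.1.add (hg.mono (by omega)), by simp [hf.2, hg a (by omega)]⟩

theorem LeadOne.sub {a : ℤ} {f g : K} (hf : LeadOne a f) (hg : VanishBelow (a + 1) g) :
    LeadOne a (f - g) := by
  rw [sub_eq_add_neg]; exact hf.add hg.neg

theorem leadOne_tK : LeadOne (-1) tK :=
  ⟨fun j hj => by simp [tK, HahnSeries.coeff_single_of_ne hj.ne], by simp [tK]⟩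

theorem leadOne_tK_zpow (n : ℤ) : LeadOne (-n) (tK ^ n) := by
  have hpow : ∀ m : ℕ, LeadOne (-(m : ℤ)) (tK ^ m) := by
    intro m
    induction m with
    | zero => simpa using LeadOne.one
    | succ m ih =>
      have := ih.mul leadOne_tK
      rw [pow_succ]
      convert this using 1
      push_cast; ring
  obtain ⟨m, rfl | rfl⟩ := n.eq_nat_or_neg
  · rw [zpow_natCast]; exact hpow m
  · rw [_root_.zpow_neg, zpow_natCast]; exact (hpow m).inv

theorem memO1_sub_one_iff (f : K) : memO1 (f - 1) ↔ LeadOne 0 f := by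
  rw [memO1_iff]
  constructor
  · intro h
    have := LeadOne.one.add (g := f - 1) (by simpa using h)
    simpa using this
  · intro h j hj
    rcases lt_or_eq_of_le (show j ≤ 0 by omega) with h0 | rfl
    · simp [h.1 j h0, h0.ne]
    · simp [h.2]

theorem eq_zero_of_memPoly_of_memO1 {f : K} (h : memPoly f) (h1 : memO1 f) : f = 0 := by
  ext j
  rcases lt_or_ge 0 j with hj | hj
  · exact h j hj
  · exact h1 j hj

theorem memPoly_zero : memPoly 0 := fun _ _ => rfl

theorem memPoly_one : memPoly 1 := fun j hj => by simp [HahnSeries.coeff_one, hj.ne']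

theorem memPoly.neg {f : K} (h : memPoly f) : memPoly (-f) := fun j hj => by simp [h j hj]

theorem exists_memPoly_sub_memO1 (f : K) : ∃ w : K, memPoly w ∧ memO1 (f - w) := by
  classical
  refine ⟨⟨fun j => if j ≤ 0 then f.coeff j else 0, f.isPWO_support.mono fun j hj => ?_⟩, ?_, ?_⟩
  · intro h0
    apply hj
    simp [h0]
  · intro j hj
    simp [hj]
  · intro j hj
    simp [hj]

/-! ### Bordered matrices -/

/-- The matrix obtained from `A` by adding a last column `c`, a last row `r` and a corner `x`. -/
def bordered {m : ℕ} (A : Matrix (Fin m) (Fin m) K) (c r : Fin m → K) (x : K) :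
    Matrix (Fin (m + 1)) (Fin (m + 1)) K :=
  Fin.snoc (α := fun _ => Fin (m + 1) → K)
    (fun i => Fin.snoc (α := fun _ => K) (A i) (c i)) (Fin.snoc (α := fun _ => K) r x)

section bordered

variable {m : ℕ} (A B : Matrix (Fin m) (Fin m) K) (c r c' r' : Fin m → K) (x x' : K)

@[simp] theorem bordered_castSucc_castSucc (i j : Fin m) :
    bordered A c r x i.castSucc j.castSucc = A i j := by simp [bordered]

@[simp] theorem bordered_castSucc_last (i : Fin m) :
    bordered A c r x i.castSucc (Fin.last m) = c i := by simp [bordered]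

@[simp] theorem bordered_last_castSucc (j : Fin m) :
    bordered A c r x (Fin.last m) j.castSucc = r j := by simp [bordered]

@[simp] theorem bordered_last_last :
    bordered A c r x (Fin.last m) (Fin.last m) = x := by simp [bordered]

end bordered

theorem matrix_ext_bordered {m : ℕ} {M N : Matrix (Fin (m + 1)) (Fin (m + 1)) K}
    (h₁ : ∀ i j : Fin m, M i.castSucc j.castSucc = N i.castSucc j.castSucc)
    (h₂ : ∀ i : Fin m, M i.castSucc (Fin.last m) = N i.castSucc (Fin.last m))
    (h₃ : ∀ j : Fin m, M (Fin.last m) j.castSucc = N (Fin.last m) j.castSucc)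
    (h₄ : M (Fin.last m) (Fin.last m) = N (Fin.last m) (Fin.last m)) : M = N := by
  ext1 i j
  induction i using Fin.lastCases with
  | last =>
    induction j using Fin.lastCases with
    | last => exact h₄
    | cast j => exact h₃ j
  | cast i =>
    induction j using Fin.lastCases with
    | last => exact h₂ i
    | cast j => exact h₁ i j

theorem isUpperUni_bordered {m : ℕ} {A : Matrix (Fin m) (Fin m) K} (hA : IsUpperUni A)
    (c : Fin m → K) : IsUpperUni (bordered A c 0 1) := by
  constructor
  · intro i
    induction i using Fin.lastCases with
    | last => simp
    | cast i => simpa using hA.1 i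
  · intro i j hij
    induction j using Fin.lastCases with
    | last => exact absurd hij (Fin.le_last i).not_gt
    | cast j =>
      induction i using Fin.lastCases with
      | last => simp
      | cast i => simpa using hA.2 i j (by simpa using hij)

theorem isLowerUni_bordered {m : ℕ} {A : Matrix (Fin m) (Fin m) K} (hA : IsLowerUni A)
    (r : Fin m → K) : IsLowerUni (bordered A 0 r 1) := by
  constructor
  · intro i
    induction i using Fin.lastCases with
    | last => simp
    | cast i => simpa using hA.1 i
  · intro i j hij
    induction i using Fin.lastCases with
    | last => exact absurd hij (Fin.le_last j).not_gt
    | cast i =>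
      induction j using Fin.lastCases with
      | last => simp
      | cast j => simpa using hA.2 i j (by simpa using hij)

theorem memN1_bordered {m : ℕ} {A : Matrix (Fin m) (Fin m) K} (hA : MemN1 A)
    {c : Fin m → K} (hc : ∀ i, memO1 (c i)) : MemN1 (bordered A c 0 1) := by
  refine ⟨isUpperUni_bordered hA.1 c, fun i j hij => ?_⟩
  induction i using Fin.lastCases with
  | last =>
    induction j using Fin.lastCases with
    | last => exact absurd rfl hij
    | cast j => intro _ _; simp
  | cast i =>
    induction j using Fin.lastCases with
    | last => simpa using hc i
    | cast j => simpa using hA.2 i j (by simpa using hij)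

/-! ### Factorizations -/

/-- A Gauss factorization of the Schur complement of the last diagonal entry extends to the
whole matrix. -/
theorem eq_mul_of_schur {m : ℕ} (M : Matrix (Fin (m + 1)) (Fin (m + 1)) K)
    (hq : M (Fin.last m) (Fin.last m) ≠ 0) {U L : Matrix (Fin m) (Fin m) K} {d : Fin m → K}
    (h : ∀ i j : Fin m, M i.castSucc j.castSucc -
      M i.castSucc (Fin.last m) * M (Fin.last m) j.castSucc / M (Fin.last m) (Fin.last m) =
        (U * diagonal d * L) i j) :
    M = bordered U (fun i => M i.castSucc (Fin.last m) / M (Fin.last m) (Fin.last m)) 0 1 *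
      diagonal (Fin.snoc (α := fun _ => K) d (M (Fin.last m) (Fin.last m))) *
      bordered L 0 (fun j => M (Fin.last m) j.castSucc / M (Fin.last m) (Fin.last m)) 1 := by
  simp only [Matrix.mul_apply (M := U * diagonal d), Matrix.mul_diagonal] at h
  apply matrix_ext_bordered
  · intro i j
    rw [Matrix.mul_apply]
    simp only [Matrix.mul_diagonal, Fin.sum_univ_castSucc]
    simp only [bordered_castSucc_castSucc, bordered_castSucc_last, bordered_last_castSucc,
      Fin.snoc_castSucc, Fin.snoc_last, ← h i j]
    field_simp
    ring
  · intro i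
    rw [Matrix.mul_apply]
    simp only [Matrix.mul_diagonal, Fin.sum_univ_castSucc]
    simp [hq]
  · intro j
    rw [Matrix.mul_apply]
    simp only [Matrix.mul_diagonal, Fin.sum_univ_castSucc]
    simp
    field_simp
  · rw [Matrix.mul_apply]
    simp only [Matrix.mul_diagonal, Fin.sum_univ_castSucc]
    simp

/-- Gauss factorization of a matrix whose off-diagonal entries lie in `𝒪₁` and whose diagonal
entries are monic units, up to one factor of `t⁻¹` in the first entry. -/
theorem exists_gauss_near_diagonal {m : ℕ} (S : Matrix (Fin m) (Fin m) K) (δ : Fin m → ℤ)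
    (hδ1 : ∀ i, δ i ≤ 1) (hδ : ∀ i j, i < j → δ j = 0)
    (hoff : ∀ i j, i ≠ j → VanishBelow 1 (S i j)) (hdiag : ∀ i, LeadOne (δ i) (S i i)) :
    ∃ (U L : Matrix (Fin m) (Fin m) K) (d : Fin m → K), MemN1 U ∧ IsLowerUni L ∧
      (∀ i, LeadOne (δ i) (d i)) ∧ S = U * diagonal d * L ∧
      ∀ i j, i < j → (U i j).coeff 1 = (S i j).coeff 1 := by
  induction m with
  | zero =>
    exact ⟨1, 1, fun i => i.elim0, ⟨⟨fun i => i.elim0, fun i => i.elim0⟩, fun i => i.elim0⟩,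
      ⟨fun i => i.elim0, fun i => i.elim0⟩, fun i => i.elim0, by ext i; exact i.elim0,
      fun i => i.elim0⟩
  | succ m ih =>
    set q := S (Fin.last m) (Fin.last m) with hq
    have hlast : ∀ _ : Fin m, LeadOne 0 q := fun i => by
      have := hdiag (Fin.last m)
      rwa [hδ i.castSucc _ (Fin.castSucc_lt_last i)] at this
    have hq0 : q ≠ 0 := (hdiag (Fin.last m)).ne_zero
    have hc : ∀ i : Fin m, VanishBelow 1 (S i.castSucc (Fin.last m)) := fun i =>
      hoff _ _ (Fin.castSucc_lt_last i).ne
    have hr : ∀ i : Fin m, VanishBelow 1 (S (Fin.last m) i.castSucc) := fun i =>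
      hoff _ _ (Fin.castSucc_lt_last i).ne'
    have hcorr : ∀ i j : Fin m,
        VanishBelow 2 (S i.castSucc (Fin.last m) * S (Fin.last m) j.castSucc / q) := fun i j => by
      rw [div_eq_mul_inv]
      exact ((hc i).mul (hr j)).mul (hlast i).inv.1
    obtain ⟨U, L, d, hU, hL, hd, hS, hcoef⟩ := ih
      (fun i j => S i.castSucc j.castSucc -
        S i.castSucc (Fin.last m) * S (Fin.last m) j.castSucc / q)
      (fun i => δ i.castSucc) (fun i => hδ1 _)
      (fun i j hij => hδ i.castSucc _ (by simpa using hij))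
      (fun i j hij => (hoff _ _ (by simpa using hij)).sub ((hcorr i j).mono (by omega)))
      (fun i => (hdiag _).sub ((hcorr i i).mono (by have := hδ1 i.castSucc; omega)))
    have hcq : ∀ i : Fin m, VanishBelow 1 (S i.castSucc (Fin.last m) / q) := fun i => by
      rw [div_eq_mul_inv]
      exact (hc i).mul (hlast i).inv.1
    refine ⟨_, _, _, memN1_bordered hU fun i => (memO1_iff _).2 (hcq i),
      isLowerUni_bordered hL _, ?_,
      eq_mul_of_schur S hq0 fun i j => congrFun (congrFun hS i) j, ?_⟩
    · intro i
      induction i using Fin.lastCases with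
      | last => simpa using hdiag _
      | cast i => simpa using hd i
    · intro i j hij
      induction i using Fin.lastCases with
      | last => exact absurd hij (Fin.le_last j).not_gt
      | cast i =>
        induction j using Fin.lastCases with
        | last =>
          rw [bordered_castSucc_last, div_eq_mul_inv]
          have := (hc i).coeff_mul (hlast i).inv.1
          rw [(hlast i).inv.2, mul_one] at this
          simpa using this
        | cast j =>
          rw [bordered_castSucc_castSucc, hcoef i j (by simpa using hij)]
          simp [hcorr i j 1 (by omega)]

/-- Every unipotent matrix lies in `N[t] · N₁[[t⁻¹]]`. -/
theorem exists_memNpoly_mul_memN1 {m : ℕ} (V : Matrix (Fin m) (Fin m) K) (hV : IsUpperUni V) :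
    ∃ a, MemNpoly a ∧ MemN1 (a * V) := by
  induction m with
  | zero =>
    exact ⟨1, ⟨⟨fun i => i.elim0, fun i => i.elim0⟩, fun i => i.elim0⟩,
      ⟨fun i => i.elim0, fun i => i.elim0⟩, fun i => i.elim0⟩
  | succ m ih =>
    obtain ⟨a, ha, haV⟩ := ih (V.submatrix Fin.castSucc Fin.castSucc)
      ⟨fun i => hV.1 _, fun i j hij => hV.2 _ _ (by simpa using hij)⟩
    choose w hw hw1 using fun i =>
      exists_memPoly_sub_memO1 ((a *ᵥ fun i : Fin m => V i.castSucc (Fin.last m)) i)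
    refine ⟨bordered a (-w) 0 1, ⟨isUpperUni_bordered ha.1 _, fun i j => ?_⟩, ?_⟩
    · induction i using Fin.lastCases with
      | last =>
        induction j using Fin.lastCases with
        | last => simpa using memPoly_one
        | cast j => simpa using memPoly_zero
      | cast i =>
        induction j using Fin.lastCases with
        | last => simpa using (hw i).neg
        | cast j => simpa using ha.2 i j
    · convert memN1_bordered haV hw1 using 1
      apply matrix_ext_bordered
      · intro i j
        simp [Matrix.mul_apply, Fin.sum_univ_castSucc, hV.2 (Fin.last m) j.castSucc
          (Fin.castSucc_lt_last j)]
      · intro i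
        simp [Matrix.mul_apply, Fin.sum_univ_castSucc, hV.1 (Fin.last m), Matrix.mulVec,
          dotProduct, sub_eq_add_neg]
      · intro j
        simp [Matrix.mul_apply, Fin.sum_univ_castSucc, hV.2 (Fin.last m) j.castSucc
          (Fin.castSucc_lt_last j)]
      · simp [Matrix.mul_apply, Fin.sum_univ_castSucc, hV.1 (Fin.last m)]

/-- Every lower unipotent matrix lies in `N₋,₁[[t⁻¹]] · N₋[t]`. -/
theorem exists_memNnegPoly_mul_memN1neg {m : ℕ} (V : Matrix (Fin m) (Fin m) K)
    (hV : IsLowerUni V) : ∃ a, MemNnegPoly a ∧ MemN1neg (V * a) := by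
  obtain ⟨a, ha, haV⟩ := exists_memNpoly_mul_memN1 Vᵀ ⟨hV.1, fun i j hij => hV.2 j i hij⟩
  refine ⟨aᵀ, ⟨⟨ha.1.1, fun i j hij => ha.1.2 j i hij⟩, fun i j => ha.2 j i⟩, ?_⟩
  have h : V * aᵀ = (a * Vᵀ)ᵀ := by simp
  rw [h]
  exact ⟨⟨haV.1.1, fun i j hij => haV.1.2 j i hij⟩, fun i j hij => haV.2 j i hij.symm⟩

/-- `N[t] ∩ N₁[[t⁻¹]]` is trivial: the `N₁[[t⁻¹]]`-part of an element of `N[t] · N₁[[t⁻¹]]` is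
unique. -/
theorem eq_of_memNpoly_mul_eq {m : ℕ} {a v U : Matrix (Fin m) (Fin m) K} (ha : MemNpoly a)
    (hv : MemN1 v) (hU : MemN1 U) (h : a * v = U) : v = U := by
  have key : ∀ N : ℕ, ∀ i j : Fin m, (j : ℕ) < N → i ≠ j → a i j = 0 := by
    intro N
    induction N with
    | zero => intro i j hj; omega
    | succ N ih =>
      intro i j hj hij
      have hsum : U i j = a i j + v i j := by
        rw [← h, Matrix.mul_apply, ← Finset.add_sum_erase _ _ (Finset.mem_univ j),
          hv.1.1, mul_one, Finset.sum_eq_single i, ha.1.1, one_mul]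
        · intro l hl hli
          rcases lt_or_gt_of_ne (Finset.ne_of_mem_erase hl) with hlj | hlj
          · rw [ih i l (by have : (l : ℕ) < j := hlj; omega) hli.symm, zero_mul]
          · rw [hv.1.2 l j hlj, mul_zero]
        · intro hi
          exact absurd (Finset.mem_erase.2 ⟨hij, Finset.mem_univ _⟩) hi
      apply eq_zero_of_memPoly_of_memO1 (ha.2 i j)
      rw [show a i j = U i j - v i j by rw [hsum]; ring, memO1_iff]
      exact ((memO1_iff _).1 (hU.2 i j hij)).sub ((memO1_iff _).1 (hv.2 i j hij))
  have h1 : a = 1 := by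
    ext1 i j
    by_cases hij : i = j
    · rw [hij, ha.1.1, Matrix.one_apply_eq]
    · rw [key (j + 1) i j (by omega) hij, Matrix.one_apply_ne hij]
  rw [← h, h1, one_mul]

/-! ### Triangular matrices -/

theorem IsUpperUni.isUpperTriangular {m : ℕ} {M : Matrix (Fin m) (Fin m) K} (hM : IsUpperUni M) :
    M.IsUpperTriangular := fun i j hij => hM.2 i j hij

theorem IsLowerUni.isLowerTriangular {m : ℕ} {M : Matrix (Fin m) (Fin m) K} (hM : IsLowerUni M) :
    M.IsLowerTriangular := fun i j hij => hM.2 i j hij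

theorem isUpperTriangular_mul_diag {m : ℕ} {M N : Matrix (Fin m) (Fin m) K}
    (hM : M.IsUpperTriangular) (hN : N.IsUpperTriangular) (i : Fin m) :
    (M * N) i i = M i i * N i i := by
  rw [Matrix.mul_apply, Finset.sum_eq_single i]
  · intro l _ hl
    rcases lt_or_gt_of_ne hl with h | h
    · rw [hM h, zero_mul]
    · rw [hN h, mul_zero]
  · simp

theorem isLowerTriangular_mul_diag {m : ℕ} {M N : Matrix (Fin m) (Fin m) K}
    (hM : M.IsLowerTriangular) (hN : N.IsLowerTriangular) (i : Fin m) :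
    (M * N) i i = M i i * N i i := by
  rw [Matrix.mul_apply, Finset.sum_eq_single i]
  · intro l _ hl
    rcases lt_or_gt_of_ne hl with h | h
    · rw [hN (i := l) (j := i) h, mul_zero]
    · rw [hM (i := i) (j := l) h, zero_mul]
  · simp

theorem IsUpperUni.mul {m : ℕ} {M N : Matrix (Fin m) (Fin m) K} (hM : IsUpperUni M)
    (hN : IsUpperUni N) : IsUpperUni (M * N) :=
  ⟨fun i => by
    rw [isUpperTriangular_mul_diag hM.isUpperTriangular hN.isUpperTriangular, hM.1, hN.1, mul_one],
    fun _ _ hij => (hM.isUpperTriangular.mul hN.isUpperTriangular) hij⟩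

theorem IsLowerUni.isUnit_det {m : ℕ} {M : Matrix (Fin m) (Fin m) K} (hM : IsLowerUni M) :
    IsUnit M.det := by
  rw [Matrix.det_of_isLowerTriangular M hM.isLowerTriangular]
  simp [hM.1]

theorem IsUpperUni.isUnit_det {m : ℕ} {M : Matrix (Fin m) (Fin m) K} (hM : IsUpperUni M) :
    IsUnit M.det := by
  rw [Matrix.det_of_isUpperTriangular hM.isUpperTriangular]
  simp [hM.1]

theorem isUnit_det_diagonal {m : ℕ} {d : Fin m → K} (hd : ∀ i, d i ≠ 0) :
    IsUnit (diagonal d).det := by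
  rw [Matrix.det_diagonal, isUnit_iff_ne_zero]
  exact Finset.prod_ne_zero_iff.2 fun i _ => hd i

/-- Uniqueness of the upper unipotent factor in a Gauss factorization. -/
theorem upperUni_factor_unique {m : ℕ} {A B S T : Matrix (Fin m) (Fin m) K} (hA : IsUpperUni A)
    (hB : IsUpperUni B) (hS : S.IsLowerTriangular) (hS' : IsUnit S.det)
    (hT : T.IsLowerTriangular) (h : A * S = B * T) : A = B := by
  let _ := S.invertibleOfIsUnitDet hS'
  let _ := B.invertibleOfIsUnitDet hB.isUnit_det
  have hlow : (T * S⁻¹).IsLowerTriangular :=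
    hT.mul (blockTriangular_inv_of_blockTriangular hS)
  have hup : (T * S⁻¹).IsUpperTriangular := by
    have : T * S⁻¹ = B⁻¹ * A := by
      rw [show T = B⁻¹ * (A * S) by rw [h, Matrix.inv_mul_cancel_left_of_invertible], mul_assoc,
        Matrix.mul_inv_cancel_right_of_invertible]
    rw [this]
    exact (blockTriangular_inv_of_blockTriangular hB.isUpperTriangular).mul hA.isUpperTriangular
  have hAB : A = B * (T * S⁻¹) := by
    rw [← mul_assoc, ← h, Matrix.mul_inv_cancel_right_of_invertible]
  have hone : T * S⁻¹ = 1 := by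
    ext1 i j
    rcases lt_trichotomy i j with hij | rfl | hij
    · rw [hlow (i := i) (j := j) hij, Matrix.one_apply_ne hij.ne]
    · have := isUpperTriangular_mul_diag hB.isUpperTriangular hup i
      rw [← hAB, hA.1, hB.1, one_mul] at this
      rw [← this, Matrix.one_apply_eq]
    · rw [hup hij, Matrix.one_apply_ne hij.ne']
  rw [hAB, hone, mul_one]

theorem exists_isLowerUni_of_isLowerTriangular {m : ℕ} {T : Matrix (Fin m) (Fin m) K}
    (hT : T.IsLowerTriangular) (hd : ∀ i, T i i ≠ 0) :
    ∃ M, IsLowerUni M ∧ T = diagonal (fun i => T i i) * M := by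
  refine ⟨diagonal (fun i => (T i i)⁻¹) * T, ⟨fun i => ?_, fun i j hij => ?_⟩, ?_⟩
  · rw [Matrix.diagonal_mul, inv_mul_cancel₀ (hd i)]
  · rw [Matrix.diagonal_mul, hT (i := i) (j := j) hij, mul_zero]
  · ext1 i j
    rw [Matrix.diagonal_mul, Matrix.diagonal_mul, mul_inv_cancel_left₀ (hd i)]

/-- The torus part of a Gauss factorization in `Gr_ν`, as one diagonal matrix. -/
theorem IsGauss.exists_diagonal {m : ℕ} {ν : Fin m → ℤ} {y u h l : Matrix (Fin m) (Fin m) K}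
    (hy : IsGauss ν y u h l) :
    ∃ d : Fin m → K, (∀ i, LeadOne (-ν i) (d i)) ∧ y = u * diagonal d * l := by
  obtain ⟨-, hh, -, rfl⟩ := hy
  refine ⟨fun i => h i i * tK ^ ν i, fun i => ?_, ?_⟩
  · simpa using ((memO1_sub_one_iff _).1 (hh.2 i)).mul (leadOne_tK_zpow (ν i))
  · rw [tPow, mul_assoc u h, ← Matrix.diagonal_mul_diagonal (fun i => h i i)]
    congr 3
    ext1 i j
    by_cases hij : i = j
    · rw [hij, Matrix.diagonal_apply_eq]
    · rw [hh.1 i j hij, Matrix.diagonal_apply_ne _ hij]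

theorem exists_isGauss_of_diagonal {m : ℕ} {ν : Fin m → ℤ} {u l : Matrix (Fin m) (Fin m) K}
    {d : Fin m → K} (hu : MemN1 u) (hl : MemN1neg l) (hd : ∀ i, LeadOne (-ν i) (d i)) :
    ∃ h, IsGauss ν (u * diagonal d * l) u h l := by
  refine ⟨diagonal fun i => d i * tK ^ (-ν i), hu, ⟨fun i j hij => ?_, fun i => ?_⟩, hl, ?_⟩
  · rw [Matrix.diagonal_apply_ne _ hij]
  · rw [Matrix.diagonal_apply_eq, memO1_sub_one_iff]
    simpa using (hd i).mul (leadOne_tK_zpow (-ν i))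
  · rw [tPow, mul_assoc u (diagonal fun i => d i * tK ^ (-ν i)), Matrix.diagonal_mul_diagonal]
    congr 3
    ext1 i
    rw [mul_assoc, ← zpow_add₀ leadOne_tK.ne_zero, neg_add_cancel, zpow_zero, mul_one]

/-! ### The block embedding -/

section block

variable {n r₁ k : ℕ} (hs : r₁ - 1 + k < n)

/-- The inclusion of the block indices. -/
def blockIdx (i : Fin (k + 1)) : Fin n := ⟨r₁ - 1 + i, by omega⟩

theorem blockIdx_lt_iff (i j : Fin (k + 1)) :
    blockIdx hs i < blockIdx hs j ↔ i < j := by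
  simp only [blockIdx, Fin.lt_def]
  omega

theorem blockIdx_injective : Function.Injective (blockIdx hs) := fun i j h => by
  have := congrArg Fin.val h
  simp only [blockIdx] at this
  exact Fin.ext (by omega)

theorem mem_range_blockIdx (i : Fin n) :
    i ∈ Set.range (blockIdx hs) ↔ r₁ - 1 ≤ (i : ℕ) ∧ (i : ℕ) ≤ r₁ - 1 + k := by
  constructor
  · rintro ⟨a, rfl⟩
    simp only [blockIdx]
    omega
  · intro h
    exact ⟨⟨i - (r₁ - 1), by omega⟩, Fin.ext (by simp only [blockIdx]; omega)⟩

/-- The diagonal block of a matrix. -/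
def block (M : Matrix (Fin n) (Fin n) K) : Matrix (Fin (k + 1)) (Fin (k + 1)) K :=
  M.submatrix (blockIdx hs) (blockIdx hs)

theorem block_apply (M : Matrix (Fin n) (Fin n) K) (i j : Fin (k + 1)) :
    block hs M i j = M (blockIdx hs i) (blockIdx hs j) := rfl

/-- The level function of the parabolic subgroup whose only nontrivial Levi block is the chosen
one. -/
def blockLevel (n r₁ k : ℕ) (i : Fin n) : ℕ :=
  if r₁ - 1 ≤ (i : ℕ) ∧ (i : ℕ) ≤ r₁ - 1 + k then r₁ - 1 else i

theorem lt_of_blockLevel_lt {i j : Fin n} (h : blockLevel n r₁ k j < blockLevel n r₁ k i) :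
    j < i := by
  rw [Fin.lt_def]
  unfold blockLevel at h
  split_ifs at h <;> omega

theorem blockLevel_blockIdx (i : Fin (k + 1)) :
    blockLevel n r₁ k (blockIdx hs i) = r₁ - 1 :=
  if_pos ((mem_range_blockIdx hs _).1 ⟨i, rfl⟩)

theorem blockLevel_ne_of_notMem {i : Fin n} (hi : i ∉ Set.range (blockIdx hs)) {l : Fin n}
    (hl : l ≠ i) : blockLevel n r₁ k l ≠ blockLevel n r₁ k i := by
  rw [mem_range_blockIdx] at hi
  have : (l : ℕ) ≠ i := fun h => hl (Fin.ext h)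
  unfold blockLevel
  split_ifs <;> omega

theorem IsUpperUni.blockTriangular {M : Matrix (Fin n) (Fin n) K} (hM : IsUpperUni M) :
    M.BlockTriangular (blockLevel n r₁ k) :=
  fun _ _ hij => hM.2 _ _ (lt_of_blockLevel_lt hij)

theorem block_mul {M N : Matrix (Fin n) (Fin n) K} (hM : M.BlockTriangular (blockLevel n r₁ k))
    (hN : N.BlockTriangular (blockLevel n r₁ k)) :
    block hs (M * N) = block hs M * block hs N := by
  ext1 i j
  rw [block_apply, Matrix.mul_apply, Matrix.mul_apply]
  refine (Fintype.sum_of_injective (blockIdx hs) (blockIdx_injective hs) _ _ ?_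
    fun l => rfl).symm
  intro l hl
  rcases lt_or_gt_of_ne (blockLevel_ne_of_notMem hs hl (l := blockIdx hs i)
    (fun h => hl ⟨i, h⟩)) with h | h
  · rw [hN (by rwa [blockLevel_blockIdx] at h ⊢), mul_zero]
  · rw [hM h, zero_mul]

theorem mul_diag_of_notMem {M N : Matrix (Fin n) (Fin n) K}
    (hM : M.BlockTriangular (blockLevel n r₁ k)) (hN : N.BlockTriangular (blockLevel n r₁ k))
    {i : Fin n} (hi : i ∉ Set.range (blockIdx hs)) : (M * N) i i = M i i * N i i := by
  rw [Matrix.mul_apply, Finset.sum_eq_single i]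
  · intro l _ hl
    rcases lt_or_gt_of_ne (blockLevel_ne_of_notMem hs hi hl) with h | h
    · rw [hM h, zero_mul]
    · rw [hN h, mul_zero]
  · simp

theorem isUpperUni_of_block {V : Matrix (Fin n) (Fin n) K}
    (hV : V.BlockTriangular (blockLevel n r₁ k))
    (hdiag : ∀ i ∉ Set.range (blockIdx hs), V i i = 1) (hblock : IsUpperUni (block hs V)) :
    IsUpperUni V := by
  constructor
  · intro i
    by_cases hi : i ∈ Set.range (blockIdx hs)
    · obtain ⟨a, rfl⟩ := hi
      exact hblock.1 a
    · exact hdiag i hi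
  · intro i j hij
    by_cases hi : i ∈ Set.range (blockIdx hs)
    · by_cases hj : j ∈ Set.range (blockIdx hs)
      · obtain ⟨a, rfl⟩ := hi
        obtain ⟨c, rfl⟩ := hj
        exact hblock.2 a c ((blockIdx_lt_iff hs _ _).1 hij)
      · apply hV
        exact (blockLevel_ne_of_notMem hs hj hij.ne').lt_or_gt.resolve_left
          fun h => absurd (lt_of_blockLevel_lt h) hij.not_gt
    · apply hV
      exact (blockLevel_ne_of_notMem hs hi hij.ne).lt_or_gt.resolve_right
        fun h => absurd (lt_of_blockLevel_lt h) hij.not_gt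

theorem MemN1.block {M : Matrix (Fin n) (Fin n) K} (hM : MemN1 M) : MemN1 (block hs M) :=
  ⟨⟨fun _ => hM.1.1 _, fun _ _ hij => hM.1.2 _ _ ((blockIdx_lt_iff hs _ _).2 hij)⟩,
    fun _ _ hij => hM.2 _ _ ((blockIdx_injective hs).ne hij)⟩

theorem MemNpoly.block {M : Matrix (Fin n) (Fin n) K} (hM : MemNpoly M) :
    MemNpoly (block hs M) :=
  ⟨⟨fun _ => hM.1.1 _, fun _ _ hij => hM.1.2 _ _ ((blockIdx_lt_iff hs _ _).2 hij)⟩,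
    fun _ _ => hM.2 _ _⟩

theorem blockEmbed_blockIdx (g : Matrix (Fin (k + 1)) (Fin (k + 1)) K) (i j : Fin (k + 1)) :
    blockEmbed n r₁ k g (blockIdx hs i) (blockIdx hs j) = g i j := by
  unfold blockEmbed
  rw [dif_pos (by simp only [blockIdx]; omega)]
  congr 1 <;> exact Fin.ext (by simp [blockIdx])

theorem block_blockEmbed (g : Matrix (Fin (k + 1)) (Fin (k + 1)) K) :
    block hs (blockEmbed n r₁ k g) = g := by
  ext1 i j
  exact blockEmbed_blockIdx hs g i j

theorem blockEmbed_of_notMem_left (g : Matrix (Fin (k + 1)) (Fin (k + 1)) K) {i : Fin n}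
    (hi : i ∉ Set.range (blockIdx hs)) (j : Fin n) :
    blockEmbed n r₁ k g i j = if i = j then 1 else 0 := by
  rw [mem_range_blockIdx] at hi
  unfold blockEmbed
  rw [dif_neg (by tauto)]

theorem blockEmbed_of_notMem_right (g : Matrix (Fin (k + 1)) (Fin (k + 1)) K) (i : Fin n)
    {j : Fin n} (hj : j ∉ Set.range (blockIdx hs)) :
    blockEmbed n r₁ k g i j = if i = j then 1 else 0 := by
  rw [mem_range_blockIdx] at hj
  unfold blockEmbed
  rw [dif_neg (by tauto)]

theorem blockTriangular_blockEmbed (hs : r₁ - 1 + k < n)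
    (g : Matrix (Fin (k + 1)) (Fin (k + 1)) K) :
    (blockEmbed n r₁ k g).BlockTriangular (blockLevel n r₁ k) := fun i j hij => by
  have hne : i ≠ j := by rintro rfl; exact lt_irrefl _ hij
  by_cases hi : i ∈ Set.range (blockIdx hs)
  · by_cases hj : j ∈ Set.range (blockIdx hs)
    · obtain ⟨a, rfl⟩ := hi
      obtain ⟨c, rfl⟩ := hj
      rw [blockLevel_blockIdx, blockLevel_blockIdx] at hij
      exact absurd hij (lt_irrefl _)
    · rw [blockEmbed_of_notMem_right hs g i hj, if_neg hne]
  · rw [blockEmbed_of_notMem_left hs g hi, if_neg hne]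

theorem blockEmbed_isLowerTriangular (hs : r₁ - 1 + k < n)
    {g : Matrix (Fin (k + 1)) (Fin (k + 1)) K}
    (hg : g.IsLowerTriangular) : (blockEmbed n r₁ k g).IsLowerTriangular := fun i j hij => by
  have hij : i < j := hij
  by_cases hi : i ∈ Set.range (blockIdx hs)
  · by_cases hj : j ∈ Set.range (blockIdx hs)
    · obtain ⟨a, rfl⟩ := hi
      obtain ⟨c, rfl⟩ := hj
      rw [blockEmbed_blockIdx]
      exact hg (i := a) (j := c) ((blockIdx_lt_iff hs _ _).1 hij)
    · rw [blockEmbed_of_notMem_right hs g i hj, if_neg hij.ne]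
  · rw [blockEmbed_of_notMem_left hs g hi, if_neg hij.ne]

theorem blockEmbed_mul_eq_one (hs : r₁ - 1 + k < n)
    {g g' : Matrix (Fin (k + 1)) (Fin (k + 1)) K} (h : g * g' = 1) :
    blockEmbed n r₁ k g * blockEmbed n r₁ k g' = 1 := by
  ext1 i j
  by_cases hi : i ∈ Set.range (blockIdx hs)
  · by_cases hj : j ∈ Set.range (blockIdx hs)
    · obtain ⟨a, rfl⟩ := hi
      obtain ⟨c, rfl⟩ := hj
      change block hs (_ * _) a c = _
      rw [block_mul hs (blockTriangular_blockEmbed hs g)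
        (blockTriangular_blockEmbed hs g'), block_blockEmbed, block_blockEmbed, h]
      simp [Matrix.one_apply, (blockIdx_injective hs).eq_iff]
    · rw [Matrix.mul_apply, Finset.sum_eq_single j]
      · simp [blockEmbed_of_notMem_right hs _ _ hj, Matrix.one_apply]
      · intro l _ hl
        rw [blockEmbed_of_notMem_right hs _ _ hj, if_neg hl, mul_zero]
      · simp
  · rw [Matrix.mul_apply, Finset.sum_eq_single i]
    · simp [blockEmbed_of_notMem_left hs _ hi, Matrix.one_apply]
    · intro l _ hl
      rw [blockEmbed_of_notMem_left hs _ hi, if_neg hl.symm, zero_mul]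
    · simp

end block

/-! ### The Gauss factorization of `y(p,e,b,g) · u` -/

theorem ymat_zero_apply (k : ℕ) (p e : ℂ) (b g : Fin (k - 1) → ℂ) {i : Fin (k + 1)}
    (hi : (i : ℕ) = 0) (j : Fin (k + 1)) :
    ymat k p e b g i j = if j = Fin.last k then Cc e else 0 := by
  unfold ymat
  rw [dif_pos hi]
  simp [Fin.ext_iff]

theorem ymat_mul_zero_apply (k : ℕ) (p e : ℂ) (b g : Fin (k - 1) → ℂ)
    (u : Matrix (Fin (k + 1)) (Fin (k + 1)) K) {i : Fin (k + 1)} (hi : (i : ℕ) = 0)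
    (j : Fin (k + 1)) : (ymat k p e b g * u) i j = Cc e * u (Fin.last k) j := by
  rw [Matrix.mul_apply, Finset.sum_eq_single (Fin.last k)]
  · rw [ymat_zero_apply k p e b g hi, if_pos rfl]
  · intro l _ hl
    rw [ymat_zero_apply k p e b g hi, if_neg hl, zero_mul]
  · simp

theorem ymat_mul_middle_apply (k : ℕ) (p e : ℂ) (b g : Fin (k - 1) → ℂ)
    (u : Matrix (Fin (k + 1)) (Fin (k + 1)) K) {i : Fin (k + 1)} (hi : 0 < (i : ℕ))
    (hik : (i : ℕ) < k) (j : Fin (k + 1)) :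
    (ymat k p e b g * u) i j =
      u i j + Cc (b ⟨k - (i : ℕ) - 1, by omega⟩) * u (Fin.last k) j := by
  have hrow : ∀ l, ymat k p e b g i l = (if l = i then 1 else 0) +
      if l = Fin.last k then Cc (b ⟨k - (i : ℕ) - 1, by omega⟩) else 0 := by
    intro l
    unfold ymat
    rw [dif_neg hi.ne', dif_neg hik.ne]
    by_cases hli : l = i
    · subst hli
      rw [dif_pos rfl, if_pos rfl, if_neg (fun h => hik.ne (by rw [h]; rfl)), add_zero]
    · rw [dif_neg fun h => hli (Fin.ext h), if_neg hli, zero_add]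
      by_cases hlk : l = Fin.last k
      · rw [if_pos hlk, dif_pos (by rw [hlk]; rfl)]
      · rw [if_neg hlk, dif_neg (show ¬(l : ℕ) = k from fun h => hlk (Fin.ext h))]
  simp [Matrix.mul_apply, hrow, add_mul, Finset.sum_add_distrib]

/-- The constants in the last row of `y(p,e,b,g)`, off the corner. -/
def ymatLastRow (k : ℕ) (e : ℂ) (g : Fin (k - 1) → ℂ) (j : Fin k) : ℂ :=
  if _h : (j : ℕ) = 0 then -e⁻¹ else -(g ⟨k - (j : ℕ) - 1, by omega⟩)

section lastRow

variable {k : ℕ} (p e : ℂ) (b g : Fin (k - 1) → ℂ)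

theorem ymat_last_castSucc (j : Fin k) :
    ymat k p e b g (Fin.last k) j.castSucc = Cc (ymatLastRow k e g j) := by
  have hk : 0 < k := j.pos
  unfold ymat ymatLastRow
  rw [dif_neg (by simpa using hk.ne'), dif_pos (by simp)]
  by_cases hj : (j : ℕ) = 0
  · rw [dif_pos (by simpa using hj), dif_pos hj]
  · rw [dif_neg (by simpa using hj), dif_neg (by simpa using j.isLt.ne), dif_neg hj]
    rfl

theorem ymat_last_last (hk : 0 < k) :
    ymat k p e b g (Fin.last k) (Fin.last k) = tK - Cc (p + ∑ l : Fin (k - 1), b l * g l) := by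
  unfold ymat
  rw [dif_neg (by simpa using hk.ne'), dif_pos (by simp), dif_neg (by simpa using hk.ne'),
    dif_pos (by simp)]

theorem coeff_Cc_mul (z : ℂ) (f : K) (j : ℤ) : (Cc z * f).coeff j = z * f.coeff j := by
  simp [Cc]

theorem VanishBelow.Cc_mul {d : ℤ} {f : K} (hf : VanishBelow d f) (z : ℂ) :
    VanishBelow d (_root_.Cc z * f) := by
  simpa using (VanishBelow.Cc z).mul hf

variable {u : Matrix (Fin (k + 1)) (Fin (k + 1)) K}

theorem ymat_mul_last_castSucc (hu : MemN1 u) (j : Fin k) :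
    VanishBelow 0 ((ymat k p e b g * u) (Fin.last k) j.castSucc) ∧
      ((ymat k p e b g * u) (Fin.last k) j.castSucc).coeff 0 = ymatLastRow k e g j := by
  have hoff : ∀ l ∈ Finset.univ.erase j,
      VanishBelow 1 (Cc (ymatLastRow k e g l) * u l.castSucc j.castSucc) := fun l hl =>
    ((memO1_iff _).1 (hu.2 _ _ (by simpa using (Finset.ne_of_mem_erase hl)))).Cc_mul _
  have hrest := VanishBelow.sum hoff
  have hform : (ymat k p e b g * u) (Fin.last k) j.castSucc = Cc (ymatLastRow k e g j) +
      ∑ l ∈ Finset.univ.erase j, Cc (ymatLastRow k e g l) * u l.castSucc j.castSucc := by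
    rw [Matrix.mul_apply, Fin.sum_univ_castSucc,
      hu.1.2 (Fin.last k) j.castSucc (Fin.castSucc_lt_last j), mul_zero, add_zero]
    simp only [ymat_last_castSucc]
    rw [← Finset.add_sum_erase _ _ (Finset.mem_univ j), hu.1.1, mul_one]
  rw [hform]
  refine ⟨(VanishBelow.Cc _).add (hrest.mono (by omega)), ?_⟩
  rw [HahnSeries.coeff_add, coeff_Cc_zero, hrest 0 (by omega), add_zero]

theorem exists_ymat_mul_last_last (hk : 0 < k) (hu : MemN1 u) :
    ∃ r : K, VanishBelow 1 r ∧ (ymat k p e b g * u) (Fin.last k) (Fin.last k) =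
      tK - Cc (p + ∑ l : Fin (k - 1), b l * g l) + r := by
  refine ⟨∑ l : Fin k, Cc (ymatLastRow k e g l) * u l.castSucc (Fin.last k),
    VanishBelow.sum fun l _ =>
      ((memO1_iff _).1 (hu.2 _ _ (Fin.castSucc_lt_last l).ne)).Cc_mul _, ?_⟩
  rw [Matrix.mul_apply, Fin.sum_univ_castSucc, ymat_last_last p e b g hk, hu.1.1, mul_one, add_comm]
  simp only [ymat_last_castSucc]

end lastRow

/-- The second coefficient of `e / (t - P + O(t⁻¹))`. -/
theorem coeff_two_div {e P : ℂ} {q r : K} (hr : VanishBelow 1 r) (hq : q = tK - Cc P + r) :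
    LeadOne (-1) q ∧ VanishBelow 1 (Cc e / q) ∧ (Cc e / q).coeff 1 = e ∧
      (Cc e / q).coeff 2 = e * P := by
  have hlead : LeadOne (-1) q := by
    rw [hq]
    exact (leadOne_tK.sub (VanishBelow.Cc P)).add (hr.mono (by omega))
  have hv : VanishBelow 1 (Cc e / q) := by
    rw [div_eq_mul_inv]
    exact hlead.inv.1.Cc_mul e
  have h1 : (Cc e / q).coeff 1 = e := by
    rw [div_eq_mul_inv, coeff_Cc_mul]
    have := hlead.inv.2
    rw [neg_neg] at this
    rw [this, mul_one]
  refine ⟨hlead, hv, h1, ?_⟩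
  have hmul : Cc e / q * tK - Cc P * (Cc e / q) + Cc e / q * r = Cc e := by
    linear_combination div_mul_cancel₀ (Cc e) hlead.ne_zero - Cc e / q * hq
  have hc := congrArg (fun f : K => f.coeff 1) hmul
  simp only [HahnSeries.coeff_add, HahnSeries.coeff_sub, coeff_Cc_mul] at hc
  have ht : (Cc e / q * tK).coeff 1 = (Cc e / q).coeff 2 := by
    rw [tK, HahnSeries.coeff_mul_single]
    norm_num
  have hr' : (Cc e / q * r).coeff 1 = 0 := (hv.mul hr) 1 (by omega)
  have he : (Cc e).coeff 1 = 0 := by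
    simp [Cc, HahnSeries.C_apply]
  rw [ht, hr', he, h1] at hc
  linear_combination hc

theorem exists_gauss_ymat_mul {k : ℕ} (hk : 0 < k) (p e : ℂ) (he : e ≠ 0)
    (b g : Fin (k - 1) → ℂ) {u : Matrix (Fin (k + 1)) (Fin (k + 1)) K} (hu : MemN1 u) :
    ∃ (v L : Matrix (Fin (k + 1)) (Fin (k + 1)) K) (d : Fin (k + 1) → K), MemN1 v ∧
      IsLowerUni L ∧
      (∀ i : Fin (k + 1), LeadOne (if (i : ℕ) = 0 then 1 else if (i : ℕ) = k then -1 else 0) (d i)) ∧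
      ymat k p e b g * u = v * diagonal d * L ∧
      (v 0 (Fin.last k)).coeff 1 = e ∧
      (v 0 (Fin.last k)).coeff 2 = e * (p + ∑ l : Fin (k - 1), b l * g l) ∧
      (∀ (i : Fin k) (hi : 0 < (i : ℕ)),
        (v i.castSucc (Fin.last k)).coeff 1 = b ⟨k - (i : ℕ) - 1, by omega⟩) ∧
      ∀ (j : Fin k) (hj : 0 < (j : ℕ)),
        (v 0 j.castSucc).coeff 1 = e * g ⟨k - (j : ℕ) - 1, by omega⟩ := by
  set Y := ymat k p e b g * u with hY
  set q := Y (Fin.last k) (Fin.last k) with hq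
  obtain ⟨r, hr, hqr⟩ := exists_ymat_mul_last_last p e b g hk hu
  obtain ⟨hqlead, hev, he1, he2⟩ := coeff_two_div (e := e) hr hqr
  have hqinv : LeadOne 1 q⁻¹ := by simpa using hqlead.inv
  have hlast := ymat_mul_last_castSucc p e b g hu
  have hulast : ∀ j : Fin k, u (Fin.last k) j.castSucc = 0 := fun j =>
    hu.1.2 _ _ (Fin.castSucc_lt_last j)
  have hcol0 : ∀ i : Fin k, (i : ℕ) = 0 → Y i.castSucc (Fin.last k) = Cc e := fun i hi => by
    rw [hY, ymat_mul_zero_apply k p e b g u (by simpa using hi), hu.1.1, mul_one]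
  have hrow0 : ∀ i j : Fin k, (i : ℕ) = 0 → Y i.castSucc j.castSucc = 0 := fun i j hi => by
    rw [hY, ymat_mul_zero_apply k p e b g u (by simpa using hi), hulast, mul_zero]
  have hcol : ∀ (i : Fin k) (hi : 0 < (i : ℕ)), Y i.castSucc (Fin.last k) =
      u i.castSucc (Fin.last k) + Cc (b ⟨k - (i : ℕ) - 1, by omega⟩) := fun i hi => by
    rw [hY, ymat_mul_middle_apply k p e b g u (by simpa using hi) (by simp), hu.1.1, mul_one]
    rfl
  have hmid : ∀ i j : Fin k, 0 < (i : ℕ) → Y i.castSucc j.castSucc = u i.castSucc j.castSucc :=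
    fun i j hi => by
      rw [hY, ymat_mul_middle_apply k p e b g u (by simpa using hi) (by simp), hulast, mul_zero,
        add_zero]
  have hucol : ∀ i : Fin k, VanishBelow 1 (u i.castSucc (Fin.last k)) := fun i =>
    (memO1_iff _).1 (hu.2 _ _ (Fin.castSucc_lt_last i).ne)
  have hcolv : ∀ i : Fin k, VanishBelow 0 (Y i.castSucc (Fin.last k)) := fun i => by
    rcases Nat.eq_zero_or_pos (i : ℕ) with hi | hi
    · rw [hcol0 i hi]; exact VanishBelow.Cc e
    · rw [hcol i hi]; exact ((hucol i).mono (by omega)).add (VanishBelow.Cc _)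
  have hcorr : ∀ i j : Fin k,
      VanishBelow 1 (Y i.castSucc (Fin.last k) * Y (Fin.last k) j.castSucc / q) := fun i j => by
    rw [div_eq_mul_inv]
    exact ((hcolv i).mul (hlast j).1).mul hqinv.1
  have hcorr0 : ∀ i j : Fin k, (i : ℕ) = 0 →
      (Y i.castSucc (Fin.last k) * Y (Fin.last k) j.castSucc / q).coeff 1 =
        e * ymatLastRow k e g j := fun i j hi => by
    rw [div_eq_mul_inv, hcol0 i hi, mul_assoc, coeff_Cc_mul]
    have := (hlast j).1.coeff_mul hqinv.1
    rw [zero_add, hqinv.2, mul_one, (hlast j).2] at this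
    rw [this]
  obtain ⟨U, L, d, hU, hL, hd, hS, hcoef⟩ := exists_gauss_near_diagonal
    (Matrix.of fun i j : Fin k => Y i.castSucc j.castSucc -
      Y i.castSucc (Fin.last k) * Y (Fin.last k) j.castSucc / q)
    (fun i => if (i : ℕ) = 0 then 1 else 0)
    (fun i => by split_ifs <;> omega)
    (fun i j hij => if_neg (by have : (i : ℕ) < j := hij; omega))
    (fun i j hij => by
      rw [Matrix.of_apply]
      rcases Nat.eq_zero_or_pos (i : ℕ) with hi | hi
      · rw [hrow0 i j hi]
        exact (VanishBelow.zero 1).sub (hcorr i j)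
      · rw [hmid i j hi]
        exact ((memO1_iff _).1 (hu.2 _ _ (by simpa using hij))).sub (hcorr i j))
    (fun i => by
      rw [Matrix.of_apply]
      rcases Nat.eq_zero_or_pos (i : ℕ) with hi | hi
      · rw [hrow0 i i hi, if_pos hi]
        refine ⟨(VanishBelow.zero 1).sub (hcorr i i), ?_⟩
        rw [HahnSeries.coeff_sub, hcorr0 i i hi, ymatLastRow, dif_pos hi]
        simp [he]
      · rw [hmid i i hi, if_neg hi.ne', hu.1.1]
        exact LeadOne.one.sub (hcorr i i))
  have hvcol : ∀ i : Fin k, VanishBelow 1 (Y i.castSucc (Fin.last k) / q) := fun i => by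
    rw [div_eq_mul_inv]
    exact (hcolv i).mul hqinv.1
  have hz : (0 : Fin (k + 1)) = Fin.castSucc ⟨0, hk⟩ := rfl
  refine ⟨_, _, _, memN1_bordered hU fun i => (memO1_iff _).2 (hvcol i),
    isLowerUni_bordered hL _, ?_,
    eq_mul_of_schur Y hqlead.ne_zero fun i j => congrFun (congrFun hS i) j, ?_, ?_, ?_, ?_⟩
  · intro i
    induction i using Fin.lastCases with
    | last => simpa [hk.ne'] using hqlead
    | cast i => simpa [i.isLt.ne] using hd i
  · rw [hz, bordered_castSucc_last, hcol0 _ rfl]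
    exact he1
  · rw [hz, bordered_castSucc_last, hcol0 _ rfl]
    exact he2
  · intro i hi
    rw [bordered_castSucc_last, div_eq_mul_inv]
    have := (hcolv i).coeff_mul hqinv.1
    rw [zero_add, hqinv.2, mul_one, hcol i hi, HahnSeries.coeff_add, hucol i 0 (by omega),
      coeff_Cc_zero, zero_add] at this
    rw [hcol i hi]
    exact this
  · intro j hj
    rw [hz, bordered_castSucc_castSucc, hcoef _ _ (Fin.lt_def.2 hj), Matrix.of_apply,
      hrow0 _ _ rfl, HahnSeries.coeff_sub, hcorr0 _ _ rfl, ymatLastRow, dif_neg hj.ne']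
    simp

/-- A Gauss factorization of `y(p,e,b,g) · u_B`, where `u_B` is the block of `u`, gives one of
`τ_α(y(p,e,b,g)) · u · D · l` whose unipotent factor has the same block. -/
theorem exists_gauss_blockEmbed_mul {n r₁ k : ℕ} (hs : r₁ - 1 + k < n)
    {Y v L : Matrix (Fin (k + 1)) (Fin (k + 1)) K} {d : Fin (k + 1) → K} (hd : ∀ i, d i ≠ 0)
    (hv : IsUpperUni v) (hL : IsLowerUni L) {u l : Matrix (Fin n) (Fin n) K} {D : Fin n → K}
    (hD : ∀ i, D i ≠ 0) (hu : IsUpperUni u) (hl : IsLowerUni l)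
    (hY : Y * block hs u = v * diagonal d * L) :
    ∃ (V M : Matrix (Fin n) (Fin n) K) (t : Fin n → K), IsUpperUni V ∧ IsLowerUni M ∧
      block hs V = v ∧ (∀ a, t (blockIdx hs a) = d a * D (blockIdx hs a)) ∧
      (∀ i ∉ Set.range (blockIdx hs), t i = D i) ∧
      blockEmbed n r₁ k Y * (u * diagonal D * l) = V * diagonal t * M := by
  have hG : (diagonal d * L).IsLowerTriangular :=
    (blockTriangular_diagonal d).mul hL.isLowerTriangular
  have hGdet : IsUnit (diagonal d * L).det := by
    rw [Matrix.det_mul]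
    exact (isUnit_det_diagonal hd).mul hL.isUnit_det
  set G := diagonal d * L with hGdef
  have hYu := (blockTriangular_blockEmbed hs Y).mul
    (hu.blockTriangular (r₁ := r₁) (k := k))
  have hGinv := blockTriangular_blockEmbed hs G⁻¹
  set V := blockEmbed n r₁ k Y * u * blockEmbed n r₁ k G⁻¹ with hV
  have hVblock : block hs V = v := by
    rw [hV, block_mul hs hYu hGinv, block_mul hs (blockTriangular_blockEmbed hs Y)
      hu.blockTriangular, block_blockEmbed, block_blockEmbed, hY, mul_assoc v, mul_assoc,
      Matrix.mul_nonsing_inv _ hGdet, mul_one]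
  have hVu : IsUpperUni V := by
    refine isUpperUni_of_block hs (hYu.mul hGinv) (fun i hi => ?_) (hVblock ▸ hv)
    rw [hV, mul_diag_of_notMem hs hYu hGinv hi, mul_diag_of_notMem hs
      (blockTriangular_blockEmbed hs Y) hu.blockTriangular hi,
      blockEmbed_of_notMem_left hs _ hi, blockEmbed_of_notMem_left hs _ hi, hu.1]
    simp
  set T := blockEmbed n r₁ k G * diagonal D * l with hT
  have hTl : (blockEmbed n r₁ k G * diagonal D).IsLowerTriangular :=
    (blockEmbed_isLowerTriangular hs hG).mul (blockTriangular_diagonal D)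
  have hTlow : T.IsLowerTriangular := hTl.mul hl.isLowerTriangular
  have hTdiag : ∀ i, T i i = blockEmbed n r₁ k G i i * D i := fun i => by
    rw [hT, isLowerTriangular_mul_diag hTl hl.isLowerTriangular, hl.1, mul_one,
      Matrix.mul_diagonal]
  have hTblock : ∀ a, T (blockIdx hs a) (blockIdx hs a) = d a * D (blockIdx hs a) := fun a => by
    rw [hTdiag, blockEmbed_blockIdx, hGdef, Matrix.diagonal_mul, hL.1, mul_one]
  have hTout : ∀ i ∉ Set.range (blockIdx hs), T i i = D i := fun i hi => by
    rw [hTdiag, blockEmbed_of_notMem_left hs _ hi, if_pos rfl, one_mul]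
  obtain ⟨M, hM, hTM⟩ := exists_isLowerUni_of_isLowerTriangular hTlow fun i => by
    by_cases hi : i ∈ Set.range (blockIdx hs)
    · obtain ⟨a, rfl⟩ := hi
      rw [hTblock]
      exact mul_ne_zero (hd a) (hD _)
    · rw [hTout i hi]
      exact hD i
  refine ⟨V, M, fun i => T i i, hVu, hM, hVblock, hTblock, hTout, ?_⟩
  rw [mul_assoc V, ← hTM, hT, hV]
  have h1 := blockEmbed_mul_eq_one hs (Matrix.nonsing_inv_mul _ hGdet)
  calc blockEmbed n r₁ k Y * (u * diagonal D * l)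
      = blockEmbed n r₁ k Y * u * 1 * (diagonal D * l) := by simp only [mul_assoc, mul_one]
    _ = _ := by rw [← h1]; simp only [mul_assoc]

/-- A matrix with a Gauss factorization over `K` with torus part in `T₁[[t⁻¹]] t^ν` has an image
under `π` in `Gr_ν`. -/
theorem exists_isPiOf {n : ℕ} {ν : Fin n → ℤ} {x V M : Matrix (Fin n) (Fin n) K}
    {t : Fin n → K} (hV : IsUpperUni V) (hM : IsLowerUni M) (ht : ∀ i, LeadOne (-ν i) (t i))
    (hx : x = V * diagonal t * M) : ∃ z, IsPiOf ν x z := by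
  obtain ⟨a, ha, haV⟩ := exists_memNpoly_mul_memN1 V hV
  obtain ⟨c, hc, hMc⟩ := exists_memNnegPoly_mul_memN1neg M hM
  obtain ⟨h, hh⟩ := exists_isGauss_of_diagonal haV hMc ht
  refine ⟨_, ⟨_, _, _, hh⟩, a, c, ha, hc, ?_⟩
  rw [hx]
  simp only [mul_assoc]

/-- The `N₁[[t⁻¹]]`-factor of `π(x)` lies in `N[t] V`, where `V` is the unipotent factor of `x`. -/
theorem IsPiOf.exists_mul_eq {n : ℕ} {ν : Fin n → ℤ} {x z V M U h L : Matrix (Fin n) (Fin n) K}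
    {t : Fin n → K} (hV : IsUpperUni V) (hM : IsLowerUni M) (ht : ∀ i, t i ≠ 0)
    (hx : x = V * diagonal t * M) (hz : IsPiOf ν x z) (hU : IsGauss ν z U h L) :
    ∃ a, MemNpoly a ∧ a * V = U := by
  obtain ⟨-, a, c, ha, hc, rfl⟩ := hz
  refine ⟨a, ha, ?_⟩
  obtain ⟨d, -, hd⟩ := hU.exists_diagonal
  refine upperUni_factor_unique (S := diagonal t * M * c) (T := diagonal d * L)
    (ha.1.mul hV) hU.1.1
    (((blockTriangular_diagonal t).mul hM.isLowerTriangular).mul hc.1.isLowerTriangular) ?_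
    ((blockTriangular_diagonal d).mul hU.2.2.1.1.isLowerTriangular) ?_
  · rw [Matrix.det_mul, Matrix.det_mul]
    exact ((isUnit_det_diagonal ht).mul hM.isUnit_det).mul hc.1.isUnit_det
  · rw [← mul_assoc U, ← hd, hx]
    simp only [mul_assoc]

/-- For `y₁ = τ_α(y(p,e,b,g)) ∈ Gr⁰_{−α}` and `y₂ ∈ Gr_{μ+α}`:
`Φ_{α,k}(m(y₁,y₂)) = e ≠ 0` (so `ξ_α(m(y₁,y₂))` is defined) and
`ξ_α(m(y₁,y₂)) = y₁`. -/
theorem statement11 (n r₁ r₂ k : ℕ) (hn : 2 ≤ n) (hr1 : 1 ≤ r₁) (hrr : r₁ ≤ r₂)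
    (hrn : r₂ < n) (hk : k = r₂ - r₁ + 1) (μ : Fin n → ℤ)
    (p e : ℂ) (he : e ≠ 0) (b g : Fin (k-1) → ℂ)
    (y₂ : Matrix (Fin n) (Fin n) K) (hy₂ : y₂ ∈ GrSlice (addAlpha n r₁ r₂ μ)) :
    (∃ z, IsPiOf μ (blockEmbed n r₁ k (ymat k p e b g) * y₂) z) ∧
    (∀ z, IsPiOf μ (blockEmbed n r₁ k (ymat k p e b g) * y₂) z →
      ∀ U h L : Matrix (Fin n) (Fin n) K, IsGauss μ z U h L →
        PhiOf n r₂ k hrn U ⟨k - 1, by omega⟩ = e ∧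
        xiOf n r₁ r₂ k hr1 hrr hrn hk U = blockEmbed n r₁ k (ymat k p e b g)) := by
  have hs : r₁ - 1 + k < n := by omega
  have hk0 : 0 < k := by omega
  obtain ⟨u, h₂, l, hy⟩ := hy₂
  obtain ⟨D, hD, rfl⟩ := hy.exists_diagonal
  obtain ⟨v, L', d, hv, hL', hd, hY, hv1, hv2, hvb, hvg⟩ :=
    exists_gauss_ymat_mul hk0 p e he b g (hy.1.block hs)
  obtain ⟨V, M, t, hV, hM, hVv, htb, hto, hx⟩ := exists_gauss_blockEmbed_mul hs
    (fun i => (hd i).ne_zero) hv.1 hL' (fun i => (hD i).ne_zero) hy.1.1 hy.2.2.1.1 hY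
  have ht : ∀ i, LeadOne (-μ i) (t i) := fun i => by
    by_cases hi : i ∈ Set.range (blockIdx hs)
    · obtain ⟨a, rfl⟩ := hi
      rw [htb]
      convert (hd a).mul (hD _) using 1
      simp only [addAlpha, alphaCo, blockIdx]
      split_ifs <;> omega
    · rw [hto i hi]
      convert hD i using 1
      rw [mem_range_blockIdx] at hi
      simp only [addAlpha, alphaCo]
      split_ifs <;> omega
  refine ⟨exists_isPiOf hV hM ht hx, fun z hz U h L hU => ?_⟩
  obtain ⟨a, ha, haU⟩ := hz.exists_mul_eq hV hM (fun i => (ht i).ne_zero) hx hU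
  have hUv : block hs U = v := by
    refine (eq_of_memNpoly_mul_eq (ha.block hs) hv (hU.1.block hs) ?_).symm
    rw [← haU, block_mul hs ha.1.blockTriangular hV.blockTriangular, hVv]
  have hentry : ∀ (i j : Fin n) (i' j' : Fin (k + 1)), (i : ℕ) = r₁ - 1 + i' →
      (j : ℕ) = r₁ - 1 + j' → U i j = v i' j' := fun i j i' j' hi hj => by
    rw [← hUv, block_apply]
    congr 1 <;> exact Fin.ext (by simpa [blockIdx])
  have hPhi : PhiOf n r₂ k hrn U ⟨k - 1, by omega⟩ = e := by
    rw [PhiOf, hentry _ _ 0 (Fin.last k) (by simp; omega) (by simp; omega), hv1]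
  have hPhib : ∀ i : Fin (k - 1), PhiOf n r₂ k hrn U ⟨i, by omega⟩ = b i := fun i => by
    rw [PhiOf, hentry _ _ (Fin.castSucc ⟨k - 1 - i, by omega⟩) (Fin.last k) (by simp; omega)
      (by simp; omega), hvb _ (by simp)]
    congr 1
    exact Fin.ext (by simp; omega)
  have hZg : ∀ i : Fin (k - 1), ZetaOf n r₁ r₂ k hr1 hrr hrn hk U ⟨k - i - 2, by omega⟩ / e =
      g i := fun i => by
    rw [ZetaOf, dif_neg (by simp; omega), hentry _ _ 0 (Fin.castSucc ⟨k - 1 - i, by omega⟩)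
      (by simp) (by simp; omega), hvg _ (by simp), mul_div_cancel_left₀ _ he]
    congr 1
    exact Fin.ext (by simp; omega)
  have hZp : ZetaOf n r₁ r₂ k hr1 hrr hrn hk U ⟨k - 1, by omega⟩ / e =
      p + ∑ i : Fin (k - 1), b i * g i := by
    rw [ZetaOf, dif_pos rfl, hentry _ _ 0 (Fin.last k) (by simp) (by simp; omega), hv2,
      mul_div_cancel_left₀ _ he]
  refine ⟨hPhi, ?_⟩
  simp only [xiOf, hPhi, hPhib, hZg, hZp, add_sub_cancel_right]

end
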